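/- Suppose the set K of feasible processes satisfies, for every τ > 0, the identity K = {z' ⋄_τ z'' : z', z'' ∈ K, z'(τ) = z''(0)} (i.e., K is closed under concatenation at every time τ > 0 and, conversely, every feasible process splits at every time τ > 0 into a feasible initial piece and a feasible tail). Then the following holds: the family of value functions V[v_T] converges uniformly on Ω as T → ∞ if and only if the family of value functions V[w_λ] converges uniformly on Ω as λ → 0⁺, and in that case the two uniform limits coincide as functions on Ω. -/

import Mathlib

open MeasureTheory Set Filter Topology

noncomputable section

/-- Concatenation `z ⋄_h z'` of two processes at time `h`:
`(z ⋄_h z')(t) = z(t)` for `t < h` and `(z ⋄_h z')(t) = z'(t - h)` for `t ≥ h`. -/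
def concat {Ω : Type*} (z z' : ℝ → Ω) (h : ℝ) : ℝ → Ω :=
  fun t => if t < h then z t else z' (t - h)

/-- The time average `v_T(z) = (1/T) ∫₀^T g(z(t)) dt`. -/
def timeAvg {Ω : Type*} (g : Ω → ℝ) (T : ℝ) (z : ℝ → Ω) : ℝ :=
  (1 / T) * ∫ t in Ioc (0 : ℝ) T, g (z t)

/-- The discounted average `w_λ(z) = λ ∫₀^∞ e^{-λ t} g(z(t)) dt`. -/
def discAvg {Ω : Type*} (g : Ω → ℝ) (lam : ℝ) (z : ℝ → Ω) : ℝ :=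
  lam * ∫ t in Ioi (0 : ℝ), Real.exp (-lam * t) * g (z t)

/-- The value function `V[J](ω) = inf { J(z) : z ∈ K, z(0) = ω }`. -/
def Val {Ω : Type*} (K : Set (ℝ → Ω)) (J : (ℝ → Ω) → ℝ) (ω : Ω) : ℝ :=
  sInf (J '' {z ∈ K | z 0 = ω})

section Value

variable {Ω : Type*} {K : Set (ℝ → Ω)} {J J' : (ℝ → Ω) → ℝ} {ω : Ω}

lemma Val_le (hJ : ∀ z ∈ K, 0 ≤ J z) {z : ℝ → Ω} (hz : z ∈ K) (h0 : z 0 = ω) :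
    Val K J ω ≤ J z := by
  refine csInf_le ⟨0, ?_⟩ ⟨z, ⟨hz, h0⟩, rfl⟩
  rintro _ ⟨y, hy, rfl⟩
  exact hJ y hy.1

lemma le_Val (hne : {z ∈ K | z 0 = ω}.Nonempty) {m : ℝ}
    (hm : ∀ z ∈ K, z 0 = ω → m ≤ J z) : m ≤ Val K J ω := by
  refine le_csInf (hne.image J) ?_
  rintro _ ⟨y, hy, rfl⟩
  exact hm y hy.1 hy.2

lemma exists_lt_Val_add (hne : {z ∈ K | z 0 = ω}.Nonempty) {δ : ℝ} (hδ : 0 < δ) :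
    ∃ z ∈ K, z 0 = ω ∧ J z < Val K J ω + δ := by
  obtain ⟨_, ⟨z, hz, rfl⟩, h⟩ :=
    exists_lt_of_csInf_lt (hne.image J) (show sInf (J '' {z ∈ K | z 0 = ω}) < Val K J ω + δ by
      simpa [Val] using hδ)
  exact ⟨z, hz.1, hz.2, h⟩

lemma Val_mem_Icc (hne : {z ∈ K | z 0 = ω}.Nonempty) (hJ : ∀ z ∈ K, J z ∈ Icc (0 : ℝ) 1) :
    Val K J ω ∈ Icc (0 : ℝ) 1 := by
  refine ⟨le_Val hne fun z hz _ => (hJ z hz).1, ?_⟩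
  obtain ⟨z, hz, h0⟩ := hne
  exact (Val_le (fun z hz => (hJ z hz).1) hz h0).trans (hJ z hz).2

/-- The value is 1-Lipschitz in the cost for the supremum norm. -/
lemma abs_Val_sub_le (hne : {z ∈ K | z 0 = ω}.Nonempty) (hJ : ∀ z ∈ K, 0 ≤ J z)
    (hJ' : ∀ z ∈ K, 0 ≤ J' z) {δ : ℝ} (h : ∀ z ∈ K, |J z - J' z| ≤ δ) :
    |Val K J ω - Val K J' ω| ≤ δ := by
  have h1 : Val K J ω - δ ≤ Val K J' ω := le_Val hne fun z hz h0 => by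
    linarith [Val_le hJ hz h0, (abs_le.1 (h z hz)).2]
  have h2 : Val K J' ω - δ ≤ Val K J ω := le_Val hne fun z hz h0 => by
    linarith [Val_le hJ' hz h0, (abs_le.1 (h z hz)).1]
  exact abs_le.2 ⟨by linarith, by linarith⟩

/-- The dynamic programming principle at time `h`. -/
lemma Val_eq_of_concat (hΓ : ∀ ω : Ω, {z ∈ K | z 0 = ω}.Nonempty) {h : ℝ} (hh : 0 < h)
    (hsplit : K = {z | ∃ z' ∈ K, ∃ z'' ∈ K, z' h = z'' 0 ∧ z = concat z' z'' h})
    (hJ : ∀ z ∈ K, 0 ≤ J z) (hJ' : ∀ z ∈ K, 0 ≤ J' z) {a : (ℝ → Ω) → ℝ} {q : ℝ}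
    (ha : ∀ z ∈ K, 0 ≤ a z) (hq : 0 ≤ q)
    (hcat : ∀ z' ∈ K, ∀ z'' ∈ K, z' h = z'' 0 → J (concat z' z'' h) = a z' + q * J' z'')
    (ω : Ω) : Val K J ω = Val K (fun z => a z + q * Val K J' (z h)) ω := by
  have hpos : ∀ z ∈ K, 0 ≤ a z + q * Val K J' (z h) := fun z hz =>
    add_nonneg (ha z hz) (mul_nonneg hq (le_Val (hΓ _) fun y hy _ => hJ' y hy))
  have hcat0 : ∀ z' z'' : ℝ → Ω, concat z' z'' h 0 = z' 0 := fun _ _ => by simp [concat, hh]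
  apply le_antisymm
  · refine le_Val (hΓ ω) fun z hz h0 => le_of_forall_pos_le_add fun δ hδ => ?_
    obtain ⟨y, hy, hy0, hlt⟩ := exists_lt_Val_add (J := J') (hΓ (z h))
      (show 0 < δ / (q + 1) by positivity)
    have hmem : concat z y h ∈ K := by
      rw [hsplit]
      exact ⟨z, hz, y, hy, hy0.symm, rfl⟩
    have h1 := Val_le hJ hmem ((hcat0 z y).trans h0)
    rw [hcat z hz y hy hy0.symm] at h1
    have h2 := mul_le_mul_of_nonneg_left hlt.le hq
    have h3 : q * (δ / (q + 1)) ≤ δ := by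
      rw [mul_div_assoc', div_le_iff₀ (by positivity)]
      nlinarith
    linarith
  · refine le_Val (hΓ ω) fun z hz h0 => ?_
    have hz' := hz
    rw [hsplit] at hz'
    obtain ⟨x, hx, y, hy, hxy, rfl⟩ := hz'
    rw [hcat x hx y hy hxy]
    refine (Val_le hpos hx ((hcat0 x y).symm.trans h0)).trans ?_
    have := mul_le_mul_of_nonneg_left (Val_le hJ' hy hxy.symm) hq
    simpa using this

end Value

section Integrals

lemma setIntegral_comp_add_right (w : ℝ → ℝ) (s : Set ℝ) (h : ℝ) :
    ∫ t in (fun t => t + h) ⁻¹' s, w (t + h) = ∫ t in s, w t :=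
  (measurePreserving_add_right volume h).setIntegral_preimage_emb
    (measurableEmbedding_addRight h) w s

variable {u : ℝ → ℝ}

lemma integrableOn_Ioc_of_mem_Icc (hu : Measurable u) (h01 : ∀ t, u t ∈ Icc (0 : ℝ) 1) (a b : ℝ) :
    IntegrableOn u (Ioc a b) :=
  Measure.integrableOn_of_bounded (M := 1) (by simp) hu.aestronglyMeasurable
    (Eventually.of_forall fun t => abs_le.2 ⟨by linarith [(h01 t).1], (h01 t).2⟩)

lemma integrableOn_exp_mul (hu : Measurable u) (h01 : ∀ t, u t ∈ Icc (0 : ℝ) 1) {lam : ℝ}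
    (hlam : 0 < lam) : IntegrableOn (fun t => Real.exp (-lam * t) * u t) (Ioi 0) := by
  refine Integrable.mono' (exp_neg_integrableOn_Ioi 0 hlam)
    (by fun_prop) (Eventually.of_forall fun t => ?_)
  rw [Real.norm_eq_abs, abs_of_nonneg (mul_nonneg (Real.exp_pos _).le (h01 t).1)]
  exact mul_le_of_le_one_right (Real.exp_pos _).le (h01 t).2

lemma integral_exp_neg_mul_Ioi_zero {lam : ℝ} (hlam : 0 < lam) :
    ∫ t in Ioi (0 : ℝ), Real.exp (-lam * t) = lam⁻¹ := by
  rw [integral_exp_mul_Ioi (by linarith) 0]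
  rw [mul_zero, Real.exp_zero, neg_div_neg_eq, one_div]

lemma setIntegral_Ioc_mem_Icc (hu : Measurable u) (h01 : ∀ t, u t ∈ Icc (0 : ℝ) 1) {h : ℝ}
    (hh : 0 ≤ h) : ∫ t in Ioc 0 h, u t ∈ Icc (0 : ℝ) h := by
  refine ⟨setIntegral_nonneg measurableSet_Ioc fun t _ => (h01 t).1, ?_⟩
  have := setIntegral_mono (integrableOn_Ioc_of_mem_Icc hu h01 0 h)
    (integrableOn_const (C := (1 : ℝ)) (by simp)) fun t => (h01 t).2
  simpa [hh] using this

/-- Replacing the discount factor by `1` on `(0, h]` costs at most `(lam * h) ^ 2`. -/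
lemma abs_discounted_sub_undiscounted_le (hu : Measurable u) (h01 : ∀ t, u t ∈ Icc (0 : ℝ) 1)
    {lam h : ℝ} (hlam : 0 < lam) (hh : 0 ≤ h) :
    |lam * (∫ t in Ioc 0 h, Real.exp (-lam * t) * u t) - lam * ∫ t in Ioc 0 h, u t|
      ≤ (lam * h) ^ 2 := by
  have hi := integrableOn_Ioc_of_mem_Icc hu h01 0 h
  have he := (integrableOn_exp_mul hu h01 hlam).mono_set
    (Ioc_subset_Ioi_self : Ioc 0 h ⊆ Ioi 0)
  rw [← mul_sub, ← integral_sub he hi, abs_mul, abs_of_pos hlam]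
  have hb : ‖∫ t in Ioc 0 h, (Real.exp (-lam * t) * u t - u t)‖
      ≤ (lam * h) * volume.real (Ioc 0 h) := by
    refine norm_setIntegral_le_of_norm_le_const (by simp) fun t ht => ?_
    have h1 : Real.exp (-lam * t) ≤ 1 := Real.exp_le_one_iff.2 (by nlinarith [ht.1])
    have h2 := Real.add_one_le_exp (-lam * t)
    have h3 : lam * t ≤ lam * h := mul_le_mul_of_nonneg_left ht.2 hlam.le
    have h4 := h01 t
    rw [Real.norm_eq_abs, abs_le]
    constructor <;> nlinarith [h4.1, h4.2, ht.1]
  rw [Real.norm_eq_abs] at hb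
  simp only [Real.volume_real_Ioc_of_le hh, sub_zero] at hb
  nlinarith

end Integrals

section Control

variable {Ω : Type*} {K : Set (ℝ → Ω)} {g : Ω → ℝ}

lemma concat_of_le {z z' : ℝ → Ω} {h t : ℝ} (hz : z h = z' 0) (ht : t ≤ h) :
    concat z z' h t = z t := by
  rcases ht.lt_or_eq with ht | rfl
  · simp [concat, ht]
  · simp [concat, hz]

lemma concat_add {z z' : ℝ → Ω} {h t : ℝ} (ht : 0 ≤ t) : concat z z' h (t + h) = z' t := by
  simp [concat, ht]

lemma timeAvg_mem_Icc (hg : ∀ ω : Ω, g ω ∈ Icc (0 : ℝ) 1) {z : ℝ → Ω}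
    (hz : Measurable fun t => g (z t)) {T : ℝ} (hT : 0 < T) : timeAvg g T z ∈ Icc (0 : ℝ) 1 := by
  obtain ⟨h0, h1⟩ := setIntegral_Ioc_mem_Icc hz (fun t => hg (z t)) hT.le
  unfold timeAvg
  refine ⟨by positivity, ?_⟩
  rw [one_div, inv_mul_le_iff₀ hT]
  simpa using h1

lemma discAvg_mem_Icc (hg : ∀ ω : Ω, g ω ∈ Icc (0 : ℝ) 1) {z : ℝ → Ω}
    (hz : Measurable fun t => g (z t)) {lam : ℝ} (hlam : 0 < lam) :
    discAvg g lam z ∈ Icc (0 : ℝ) 1 := by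
  have hpos : 0 ≤ ∫ t in Ioi (0 : ℝ), Real.exp (-lam * t) * g (z t) :=
    setIntegral_nonneg measurableSet_Ioi fun t _ => mul_nonneg (Real.exp_pos _).le (hg _).1
  refine ⟨mul_nonneg hlam.le hpos, ?_⟩
  have := setIntegral_mono (integrableOn_exp_mul hz (fun t => hg (z t)) hlam)
    (exp_neg_integrableOn_Ioi 0 hlam)
    fun t => mul_le_of_le_one_right (Real.exp_pos _).le (hg (z t)).2
  rw [integral_exp_neg_mul_Ioi_zero hlam] at this
  have := mul_le_mul_of_nonneg_left this hlam.le
  rwa [mul_inv_cancel₀ hlam.ne'] at this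

lemma timeAvg_concat (hg : ∀ ω : Ω, g ω ∈ Icc (0 : ℝ) 1) {z z' : ℝ → Ω} {h T : ℝ} (hh : 0 ≤ h)
    (hT : h < T) (hm : Measurable fun t => g (concat z z' h t)) (hz : z h = z' 0) :
    timeAvg g T (concat z z' h)
      = (1 / T) * (∫ t in Ioc 0 h, g (z t)) + (1 - h / T) * timeAvg g (T - h) z' := by
  have hi := integrableOn_Ioc_of_mem_Icc hm (fun t => hg _)
  have h1 : ∫ t in Ioc 0 h, g (concat z z' h t) = ∫ t in Ioc 0 h, g (z t) :=
    setIntegral_congr_fun measurableSet_Ioc fun t ht => by simp only [concat_of_le hz ht.2]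
  have h2 : ∫ t in Ioc h T, g (concat z z' h t) = ∫ t in Ioc 0 (T - h), g (z' t) := by
    rw [← setIntegral_comp_add_right _ _ h, preimage_add_const_Ioc, sub_self]
    exact setIntegral_congr_fun measurableSet_Ioc fun t ht => by simp only [concat_add ht.1.le]
  have hT0 : T ≠ 0 := by linarith
  have hTh : T - h ≠ 0 := by linarith
  unfold timeAvg
  rw [← Ioc_union_Ioc_eq_Ioc hh hT.le, setIntegral_union
    (Ioc_disjoint_Ioc_of_le le_rfl) measurableSet_Ioc (hi _ _) (hi _ _), h1, h2]
  field_simp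

lemma discAvg_concat (hg : ∀ ω : Ω, g ω ∈ Icc (0 : ℝ) 1) {z z' : ℝ → Ω} {h lam : ℝ} (hh : 0 ≤ h)
    (hlam : 0 < lam) (hm : Measurable fun t => g (concat z z' h t)) (hz : z h = z' 0) :
    discAvg g lam (concat z z' h)
      = lam * (∫ t in Ioc 0 h, Real.exp (-lam * t) * g (z t))
        + Real.exp (-lam * h) * discAvg g lam z' := by
  have hi := integrableOn_exp_mul hm (fun t => hg _) hlam
  have h1 : ∫ t in Ioc 0 h, Real.exp (-lam * t) * g (concat z z' h t)
      = ∫ t in Ioc 0 h, Real.exp (-lam * t) * g (z t) :=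
    setIntegral_congr_fun measurableSet_Ioc fun t ht => by simp only [concat_of_le hz ht.2]
  have h2 : ∫ t in Ioi h, Real.exp (-lam * t) * g (concat z z' h t)
      = Real.exp (-lam * h) * ∫ t in Ioi 0, Real.exp (-lam * t) * g (z' t) := by
    rw [← setIntegral_comp_add_right _ _ h, preimage_add_const_Ioi, sub_self,
      ← integral_const_mul]
    refine setIntegral_congr_fun measurableSet_Ioi fun t ht => ?_
    simp only [concat_add (le_of_lt ht), mul_add, Real.exp_add]
    ring
  unfold discAvg
  rw [← Ioc_union_Ioi_eq_Ioi hh, setIntegral_union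
    (Ioc_disjoint_Ioi le_rfl) measurableSet_Ioi (hi.mono_set Ioc_subset_Ioi_self)
    (hi.mono_set (Ioi_subset_Ioi hh)), h1, h2, Ioc_union_Ioi_eq_Ioi hh]
  ring

/-- The optimal value of running the system up to time `c * T` at rate `1 / T`, then paying
`(1 - c) * f` at the state reached. -/
def stepVal (K : Set (ℝ → Ω)) (g : Ω → ℝ) (c T : ℝ) (f : Ω → ℝ) (ω : Ω) : ℝ :=
  Val K (fun z => (1 / T) * (∫ t in Ioc 0 (c * T), g (z t)) + (1 - c) * f (z (c * T))) ω

lemma stepVal_cost_nonneg (hg : ∀ ω : Ω, g ω ∈ Icc (0 : ℝ) 1) {c T : ℝ} (hc1 : c ≤ 1)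
    (hT : 0 < T) {f : Ω → ℝ} (hf : ∀ ω, 0 ≤ f ω) (z : ℝ → Ω) :
    0 ≤ (1 / T) * (∫ t in Ioc 0 (c * T), g (z t)) + (1 - c) * f (z (c * T)) :=
  add_nonneg (mul_nonneg (by positivity)
    (setIntegral_nonneg measurableSet_Ioc fun t _ => (hg _).1))
    (mul_nonneg (by linarith) (hf _))

lemma abs_stepVal_sub_le (hg : ∀ ω : Ω, g ω ∈ Icc (0 : ℝ) 1)
    (hΓ : ∀ ω : Ω, {z ∈ K | z 0 = ω}.Nonempty) {c T : ℝ} (hc1 : c ≤ 1) (hT : 0 < T)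
    {f f' : Ω → ℝ} (hf : ∀ ω, 0 ≤ f ω) (hf' : ∀ ω, 0 ≤ f' ω) {B : ℝ}
    (hB : ∀ ω, |f ω - f' ω| ≤ B) (ω : Ω) :
    |stepVal K g c T f ω - stepVal K g c T f' ω| ≤ (1 - c) * B := by
  refine abs_Val_sub_le (hΓ ω) (fun z _ => stepVal_cost_nonneg hg hc1 hT hf z)
    (fun z _ => stepVal_cost_nonneg hg hc1 hT hf' z) fun z _ => ?_
  rw [add_sub_add_left_eq_sub, ← mul_sub, abs_mul, abs_of_nonneg (by linarith)]
  exact mul_le_mul_of_nonneg_left (hB _) (by linarith)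

lemma Val_timeAvg_eq_stepVal (hg : ∀ ω : Ω, g ω ∈ Icc (0 : ℝ) 1)
    (hmeas : ∀ z ∈ K, Measurable fun t : ℝ => g (z t))
    (hΓ : ∀ ω : Ω, {z ∈ K | z 0 = ω}.Nonempty)
    (hsplit : ∀ τ : ℝ, 0 < τ →
      K = {z | ∃ z' ∈ K, ∃ z'' ∈ K, z' τ = z'' 0 ∧ z = concat z' z'' τ})
    {c T : ℝ} (hc : 0 < c) (hc1 : c < 1) (hT : 0 < T) (ω : Ω) :
    Val K (timeAvg g T) ω = stepVal K g c T (Val K (timeAvg g ((1 - c) * T))) ω := by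
  have hcT : 0 < c * T := mul_pos hc hT
  have hcT' : 0 < (1 - c) * T := mul_pos (by linarith) hT
  refine Val_eq_of_concat hΓ hcT (hsplit _ hcT)
    (fun z hz => (timeAvg_mem_Icc hg (hmeas z hz) hT).1)
    (fun z hz => (timeAvg_mem_Icc hg (hmeas z hz) hcT').1)
    (a := fun z => (1 / T) * ∫ t in Ioc 0 (c * T), g (z t)) (fun z _ => mul_nonneg (by positivity)
      (setIntegral_nonneg measurableSet_Ioc fun t _ => (hg _).1)) (by linarith)
    (fun x hx y hy hxy => ?_) ω
  have hmem : concat x y (c * T) ∈ K := by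
    rw [hsplit _ hcT]
    exact ⟨x, hx, y, hy, hxy, rfl⟩
  rw [timeAvg_concat hg hcT.le (by nlinarith) (hmeas _ hmem) hxy, mul_div_cancel_right₀ _ hT.ne',
    show T - c * T = (1 - c) * T by ring]

lemma abs_Val_discAvg_sub_stepVal_le (hg : ∀ ω : Ω, g ω ∈ Icc (0 : ℝ) 1)
    (hmeas : ∀ z ∈ K, Measurable fun t : ℝ => g (z t))
    (hΓ : ∀ ω : Ω, {z ∈ K | z 0 = ω}.Nonempty)
    (hsplit : ∀ τ : ℝ, 0 < τ →
      K = {z | ∃ z' ∈ K, ∃ z'' ∈ K, z' τ = z'' 0 ∧ z = concat z' z'' τ})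
    {c T : ℝ} (hc : 0 < c) (hc1 : c < 1) (hT : 0 < T) (ω : Ω) :
    |Val K (discAvg g T⁻¹) ω - stepVal K g c T (Val K (discAvg g T⁻¹)) ω| ≤ 2 * c ^ 2 := by
  have hcT : 0 < c * T := mul_pos hc hT
  have hT' : 0 < T⁻¹ := inv_pos.2 hT
  have hTc : T⁻¹ * (c * T) = c := by field_simp
  have hJ : ∀ z ∈ K, discAvg g T⁻¹ z ∈ Icc (0 : ℝ) 1 :=
    fun z hz => discAvg_mem_Icc hg (hmeas z hz) hT'
  have hW : ∀ ω, Val K (discAvg g T⁻¹) ω ∈ Icc (0 : ℝ) 1 := fun ω => Val_mem_Icc (hΓ ω) hJ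
  have ha : ∀ z ∈ K, 0 ≤ T⁻¹ * ∫ t in Ioc 0 (c * T), Real.exp (-T⁻¹ * t) * g (z t) :=
    fun z _ => mul_nonneg hT'.le (setIntegral_nonneg measurableSet_Ioc fun t _ =>
      mul_nonneg (Real.exp_pos _).le (hg _).1)
  have hdpp := Val_eq_of_concat hΓ hcT (hsplit _ hcT) (fun z hz => (hJ z hz).1)
    (fun z hz => (hJ z hz).1) ha (Real.exp_pos (-T⁻¹ * (c * T))).le
    (fun x hx y hy hxy => by
      have hmem : concat x y (c * T) ∈ K := by
        rw [hsplit _ hcT]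
        exact ⟨x, hx, y, hy, hxy, rfl⟩
      exact discAvg_concat hg hcT.le hT' (hmeas _ hmem) hxy) ω
  rw [hdpp]
  refine abs_Val_sub_le (hΓ ω)
    (fun z hz => add_nonneg (ha z hz) (mul_nonneg (Real.exp_pos _).le (hW _).1))
    (fun z _ => stepVal_cost_nonneg hg hc1.le hT (fun ω => (hW ω).1) z) fun z hz => ?_
  have h1 := abs_discounted_sub_undiscounted_le (hmeas z hz) (fun t => hg (z t)) hT' hcT.le
  have h2 : |Real.exp (-c) - 1 - (-c)| ≤ (-c) ^ 2 :=
    Real.abs_exp_sub_one_sub_id_le (by rw [abs_neg, abs_of_pos hc]; exact hc1.le)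
  obtain ⟨hw0, hw1⟩ := hW (z (c * T))
  rw [hTc] at h1
  rw [neg_mul, hTc, one_div]
  have h3 : |(Real.exp (-c) - 1 - (-c)) * Val K (discAvg g T⁻¹) (z (c * T))| ≤ c ^ 2 := by
    rw [abs_mul, abs_of_nonneg hw0]
    have := mul_le_mul h2 hw1 hw0 (by positivity)
    simpa using this
  refine (le_of_eq ?_).trans ((abs_add_le _ _).trans ((add_le_add h1 h3).trans_eq (by ring)))
  congr 1
  ring

/-- If two families of functions are both approximate fixed points, up to `2 * c ^ 2`, of the
same dynamic programming operators, then uniform limits are transferred from one to the other. -/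
lemma tendstoUniformly_of_approx_stepVal (hg : ∀ ω : Ω, g ω ∈ Icc (0 : ℝ) 1)
    (hΓ : ∀ ω : Ω, {z ∈ K | z 0 = ω}.Nonempty) {U U' : ℝ → Ω → ℝ} {a a' : ℝ → ℝ}
    (ha : ∀ c, 0 < c → c < 1 → 0 < a c) (ha' : ∀ c, 0 < c → c < 1 → 0 < a' c)
    (hU01 : ∀ T, 0 < T → ∀ ω, U T ω ∈ Icc (0 : ℝ) 1)
    (hU01' : ∀ T, 0 < T → ∀ ω, U' T ω ∈ Icc (0 : ℝ) 1)
    (hU : ∀ c T, 0 < c → c < 1 → 0 < T → ∀ ω,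
      |U T ω - stepVal K g c T (U (a c * T)) ω| ≤ 2 * c ^ 2)
    (hU' : ∀ c T, 0 < c → c < 1 → 0 < T → ∀ ω,
      |U' T ω - stepVal K g c T (U' (a' c * T)) ω| ≤ 2 * c ^ 2)
    {G : Ω → ℝ} (hG : TendstoUniformly U G atTop) : TendstoUniformly U' G atTop := by
  have hG01 : ∀ ω, G ω ∈ Icc (0 : ℝ) 1 := fun ω =>
    isClosed_Icc.mem_of_tendsto (hG.tendsto_at ω)
      ((eventually_gt_atTop 0).mono fun T hT => hU01 T hT ω)
  rw [Metric.tendstoUniformly_iff] at hG ⊢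
  intro ε hε
  obtain ⟨c, hc, hcε⟩ : ∃ c, 0 < c ∧ c < min 1 (ε / 7) := exists_between (by positivity)
  have hc1 : c < 1 := hcε.trans_le (min_le_left _ _)
  have hcε : c < ε / 7 := hcε.trans_le (min_le_right _ _)
  have hac := ha c hc hc1
  have hac' := ha' c hc hc1
  have hc2 : 0 < c ^ 2 := by positivity
  have hfix : ∀ᶠ T in atTop, ∀ ω, |stepVal K g c T G ω - G ω| ≤ 4 * c ^ 2 := by
    filter_upwards [hG _ hc2, (tendsto_id.const_mul_atTop hac).eventually (hG _ hc2),
      eventually_gt_atTop 0] with T h1 h2 hT ω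
    have h3 := abs_stepVal_sub_le hg hΓ hc1.le hT (fun ω => (hG01 ω).1)
      (fun ω => (hU01 (a c * T) (mul_pos hac hT) ω).1) (B := c ^ 2)
      (fun ω => (Real.dist_eq (G ω) (U (a c * T) ω) ▸ h2 ω).le) ω
    have h4 := hU c T hc hc1 hT ω
    have h5 := h1 ω
    rw [Real.dist_eq] at h5
    rw [abs_le] at h3 h4 ⊢
    rw [abs_lt] at h5
    constructor <;> nlinarith
  obtain ⟨T₀, hT₀, hfix⟩ : ∃ T₀ : ℝ, 0 < T₀ ∧
      ∀ T ≥ T₀, ∀ ω, |stepVal K g c T G ω - G ω| ≤ 4 * c ^ 2 := by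
    obtain ⟨T₁, h⟩ := eventually_atTop.1 hfix
    exact ⟨max T₁ 1, by positivity, fun T hT => h T ((le_max_left _ _).trans hT)⟩
  have hiter : ∀ n : ℕ, ∀ᶠ T in atTop, ∀ ω, |U' T ω - G ω| ≤ (1 - c) ^ n + 6 * c := by
    intro n
    induction n with
    | zero =>
      filter_upwards [eventually_gt_atTop 0] with T hT ω
      have h1 := hU01' T hT ω
      have h2 := hG01 ω
      rw [pow_zero, abs_le]
      constructor <;> linarith [h1.1, h1.2, h2.1, h2.2]
    | succ n ih =>
      filter_upwards [(tendsto_id.const_mul_atTop hac').eventually ih,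
        eventually_ge_atTop T₀] with T h1 hT ω
      have hT0 : 0 < T := hT₀.trans_le hT
      have h3 := abs_stepVal_sub_le hg hΓ hc1.le hT0
        (fun ω => (hU01' (a' c * T) (mul_pos hac' hT0) ω).1) (fun ω => (hG01 ω).1) h1 ω
      have h4 := hU' c T hc hc1 hT0 ω
      have h5 := hfix T hT ω
      rw [abs_le] at h3 h4 h5 ⊢
      constructor <;> nlinarith [pow_succ (1 - c) n]
  obtain ⟨n, hn⟩ := exists_pow_lt_of_lt_one hc (show 1 - c < 1 by linarith)
  filter_upwards [hiter n] with T hT ω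
  rw [dist_comm, Real.dist_eq]
  linarith [hT ω]

end Control

lemma tendstoUniformly_nhdsGT_zero_iff {Ω : Type*} {W : ℝ → Ω → ℝ} {G : Ω → ℝ} :
    TendstoUniformly W G (𝓝[>] (0 : ℝ)) ↔ TendstoUniformly (fun T => W T⁻¹) G atTop := by
  simp only [TendstoUniformly, ← inv_atTop₀, ← Filter.map_inv, eventually_map]

/-- **The Uniform Tauberian Theorem for abstract control systems.**
If `K` satisfies, for every `τ > 0`,
`K = {z' ⋄_τ z'' : z', z'' ∈ K, z'(τ) = z''(0)}`, then the value functions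
`V[v_T]` converge uniformly on `Ω` as `T → ∞` iff the value functions `V[w_λ]`
converge uniformly on `Ω` as `λ → 0⁺`, and in that case the two uniform limits
coincide. -/
theorem uniform_tauberian {Ω : Type*} [Nonempty Ω] (K : Set (ℝ → Ω)) (hK : K.Nonempty)
    (g : Ω → ℝ) (hg : ∀ ω : Ω, g ω ∈ Icc (0 : ℝ) 1)
    (hmeas : ∀ z ∈ K, Measurable fun t : ℝ => g (z t))
    (hΓ : ∀ ω : Ω, {z ∈ K | z 0 = ω}.Nonempty)
    (hsplit : ∀ τ : ℝ, 0 < τ →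
      K = {z | ∃ z' ∈ K, ∃ z'' ∈ K, z' τ = z'' 0 ∧ z = concat z' z'' τ}) :
    ((∃ F : Ω → ℝ, TendstoUniformly (fun T ω => Val K (timeAvg g T) ω) F atTop) ↔
      (∃ G : Ω → ℝ,
        TendstoUniformly (fun lam ω => Val K (discAvg g lam) ω) G (𝓝[>] (0 : ℝ)))) ∧
    (∀ F G : Ω → ℝ,
      TendstoUniformly (fun T ω => Val K (timeAvg g T) ω) F atTop →
      TendstoUniformly (fun lam ω => Val K (discAvg g lam) ω) G (𝓝[>] (0 : ℝ)) →
      F = G) := by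
  have hVW : ∀ F : Ω → ℝ, TendstoUniformly (fun T ω => Val K (timeAvg g T) ω) F atTop ↔
      TendstoUniformly (fun lam ω => Val K (discAvg g lam) ω) F (𝓝[>] (0 : ℝ)) := by
    intro F
    have hV01 : ∀ T, 0 < T → ∀ ω, Val K (timeAvg g T) ω ∈ Icc (0 : ℝ) 1 := fun T hT ω =>
      Val_mem_Icc (hΓ ω) fun z hz => timeAvg_mem_Icc hg (hmeas z hz) hT
    have hW01 : ∀ T, 0 < T → ∀ ω, Val K (discAvg g T⁻¹) ω ∈ Icc (0 : ℝ) 1 := fun T hT ω =>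
      Val_mem_Icc (hΓ ω) fun z hz => discAvg_mem_Icc hg (hmeas z hz) (inv_pos.2 hT)
    have hV : ∀ c T, 0 < c → c < 1 → 0 < T → ∀ ω, |Val K (timeAvg g T) ω
        - stepVal K g c T (Val K (timeAvg g ((1 - c) * T))) ω| ≤ 2 * c ^ 2 := by
      intro c T hc hc1 hT ω
      rw [← Val_timeAvg_eq_stepVal hg hmeas hΓ hsplit hc hc1 hT ω, sub_self, abs_zero]
      positivity
    have hW : ∀ c T, 0 < c → c < 1 → 0 < T → ∀ ω, |Val K (discAvg g T⁻¹) ω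
        - stepVal K g c T (Val K (discAvg g (1 * T)⁻¹)) ω| ≤ 2 * c ^ 2 := by
      intro c T hc hc1 hT ω
      rw [one_mul]
      exact abs_Val_discAvg_sub_stepVal_le hg hmeas hΓ hsplit hc hc1 hT ω
    have ha : ∀ c : ℝ, 0 < c → c < 1 → 0 < 1 - c := fun c _ h => by linarith
    have ha' : ∀ c : ℝ, 0 < c → c < 1 → (0 : ℝ) < 1 := fun _ _ _ => one_pos
    rw [tendstoUniformly_nhdsGT_zero_iff]
    exact ⟨tendstoUniformly_of_approx_stepVal (U := fun T => Val K (timeAvg g T))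
        (U' := fun T => Val K (discAvg g T⁻¹)) hg hΓ ha ha' hV01 hW01 hV hW,
      tendstoUniformly_of_approx_stepVal (U := fun T => Val K (discAvg g T⁻¹))
        (U' := fun T => Val K (timeAvg g T)) hg hΓ ha' ha hW01 hV01 hW hV⟩
  refine ⟨exists_congr hVW, fun F G hF hG => funext fun ω => ?_⟩
  exact tendsto_nhds_unique (hF.tendsto_at ω) (((hVW G).2 hG).tendsto_at ω)
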